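/- For any A > 1, any λ ∈ [0,1), any n₀ ∈ ℕ, and any sequence (α_n)_{n∈ℕ} of positive reals converging to 0, there exist n ∈ ℕ with n ≥ n₀ and a function f = f_n ∈ C^1 such that f ≥ 0 on I, f ≡ 0 on [-1, -1/2], and for every polynomial P_n of degree ≤ n which is nonnegative on (λ - 1/n, λ + 1/n) and satisfies P_n(λ) = f(λ), one has ‖f - P_n‖ > A α_n n^{-2/3} ω₄(f', n^{-1}). Hence the pointwise estimate |f(x)-P_n(x)| ≤ c ρ_n(x) ω₄(f', ρ_n(x)) fails for positive approximation with interpolation at an interior point λ. -/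

import Mathlib

/-- The `k`-th modulus of smoothness of `g` with step bound `t` on `[a,b]`. -/
noncomputable def omegaK (g : ℝ → ℝ) (k : ℕ) (t a b : ℝ) : ℝ :=
  sSup {v : ℝ | ∃ h x : ℝ, 0 < h ∧ h ≤ t ∧ a ≤ x ∧ x + (k : ℝ) * h ≤ b ∧
    v = |∑ i ∈ Finset.range (k + 1),
      (-1 : ℝ) ^ (k - i) * (k.choose i : ℝ) * g (x + (i : ℝ) * h)|}

/-- The sup norm of `g` on `[a,b]`. -/
noncomputable def supNorm (g : ℝ → ℝ) (a b : ℝ) : ℝ :=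
  sSup ((fun x => |g x|) '' Set.Icc a b)

open Polynomial in
/-- The endpoint case of Markov's inequality, on `[0, r]`. -/
lemma derivative_eval_zero_le_of_abs_le {W : ℝ[X]} {n : ℕ} (hW : W.natDegree ≤ n) {r M : ℝ}
    (hr : 0 < r) (hM : 0 < M) (hbd : ∀ t ∈ Set.Icc 0 r, |W.eval t| ≤ M) :
    W.derivative.eval 0 ≤ 2 * (n : ℝ) ^ 2 / r * M := by
  set Y : ℝ[X] := C (-M⁻¹) * W.comp (C (r / 2) * (1 - X)) with hY
  have hlin : (C (r / 2) * (1 - X) : ℝ[X]).natDegree ≤ 1 := by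
    compute_degree
  have hdeg : Y.degree ≤ n := by
    refine natDegree_le_iff_degree_le.mp ?_
    refine (natDegree_C_mul_le _ _).trans (natDegree_comp_le.trans ?_)
    calc _ ≤ n * 1 := Nat.mul_le_mul hW hlin
      _ = n := mul_one n
  have hYbd : ∀ x ∈ Set.Icc (-1 : ℝ) 1, |Y.eval x| ≤ 1 := by
    rintro x ⟨hx1, hx2⟩
    have h := hbd (r / 2 * (1 - x)) ⟨by nlinarith, by nlinarith⟩
    have : Y.eval x = -M⁻¹ * W.eval (r / 2 * (1 - x)) := by simp [hY]
    rw [this, abs_mul, abs_neg, abs_of_pos (inv_pos.mpr hM), inv_mul_le_iff₀ hM]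
    simpa using h
  have h := Chebyshev.eval_iterate_derivative_le_of_forall_abs_le_one (k := 1) le_rfl hdeg hYbd
  rw [Function.iterate_one, Chebyshev.derivative_T_eval_one] at h
  have hd : Y.derivative.eval 1 = M⁻¹ * (r / 2) * W.derivative.eval 0 := by
    simp [hY, derivative_comp]
    ring
  rw [hd] at h
  push_cast at h
  have h2 := mul_le_mul_of_nonneg_left h (show 0 ≤ 2 / r * M by positivity)
  calc W.derivative.eval 0 = 2 / r * M * (M⁻¹ * (r / 2) * W.derivative.eval 0) := by
        field_simp
    _ ≤ _ := h2
    _ = _ := by ring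

open Polynomial in
lemma derivative_eval_zero_nonneg {V : ℝ[X]} {ε : ℝ} (hε : 0 < ε) (h0 : V.eval 0 = 0)
    (hV : ∀ t ∈ Set.Ioo 0 ε, 0 ≤ V.eval t) : 0 ≤ V.derivative.eval 0 := by
  have h := (V.hasDerivAt 0).hasDerivWithinAt (s := Set.Ioi 0)
  rw [hasDerivWithinAt_iff_tendsto_slope' (by simp)] at h
  refine ge_of_tendsto h ?_
  filter_upwards [Ioo_mem_nhdsGT hε] with t ht
  rw [slope_def_field, h0]
  simpa using div_nonneg (hV t ht) ht.1.le

open Polynomial in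
lemma contract_two_eval_sq (Q : ℝ[X]) (s : ℝ) :
    (contract 2 Q).eval (s ^ 2) = (Q.eval s + Q.eval (-s)) / 2 := by
  have h : expand ℝ 2 (contract 2 Q) = C (1 / 2) * (Q + Q.comp (C (-1) * X)) := by
    ext k
    rw [coeff_expand two_pos, coeff_C_mul, coeff_add, comp_C_mul_X_coeff]
    split_ifs with hk
    · rw [coeff_contract two_ne_zero, Nat.div_mul_cancel hk, (even_iff_two_dvd.mpr hk).neg_one_pow]
      ring
    · rw [(Nat.not_even_iff_odd.mp (mt even_iff_two_dvd.mp hk)).neg_one_pow]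
      ring
  rw [← expand_eval, h]
  simp
  ring

open Polynomial in
/-- A polynomial which touches zero from above at `c` cannot be too close to a quartic which is
concave at `c`. -/
lemma sq_le_of_abs_eval_sub_le {P : ℝ[X]} {n : ℕ} (hn : 2 ≤ n) (hP : P.natDegree ≤ n)
    {c δ ε b M : ℝ} (hδ : 0 < δ) (hε : 0 < ε) (hM : 0 < M) (h0 : P.eval c = 0)
    (hpos : ∀ x ∈ Set.Ioo (c - ε) (c + ε), 0 ≤ P.eval x)
    (hbd : ∀ s ∈ Set.Icc (-δ) δ, |P.eval (c + s) - (s ^ 2 - b ^ 2) ^ 2| ≤ M) :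
    b ^ 2 ≤ (n : ℝ) ^ 2 / δ ^ 2 * M := by
  set V : ℝ[X] := contract 2 (P.comp (X + C c)) with hV
  have hVeval (s : ℝ) : V.eval (s ^ 2) = (P.eval (c + s) + P.eval (c + -s)) / 2 := by
    rw [hV, contract_two_eval_sq]
    simp [add_comm]
  have hVdeg : V.natDegree ≤ n := by
    have h1 : (P.comp (X + C c)).natDegree ≤ n := by
      rw [natDegree_comp, natDegree_X_add_C, mul_one]
      exact hP
    rw [natDegree_le_iff_coeff_eq_zero]
    intro k hk
    rw [hV, coeff_contract two_ne_zero]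
    exact coeff_eq_zero_of_natDegree_lt (by omega)
  have hVnonneg : 0 ≤ V.derivative.eval 0 := by
    refine derivative_eval_zero_nonneg (ε := ε ^ 2) (by positivity) ?_ ?_
    · have := hVeval 0
      simpa [h0] using this
    · rintro t ⟨ht0, ht1⟩
      have hlt : √t < ε := (Real.sqrt_lt' hε).mpr ht1
      have hs := Real.sqrt_nonneg t
      rw [← Real.sq_sqrt ht0.le, hVeval]
      have h1 := hpos (c + √t) ⟨by linarith, by linarith⟩
      have h2 := hpos (c + -√t) ⟨by linarith, by linarith⟩
      linarith
  have hbdW : ∀ t ∈ Set.Icc 0 (δ ^ 2), |(V - (X - C (b ^ 2)) ^ 2).eval t| ≤ M := by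
    rintro t ⟨ht0, ht1⟩
    have hle : √t ≤ δ := Real.sqrt_le_iff.mpr ⟨hδ.le, ht1⟩
    have hs := Real.sqrt_nonneg t
    rw [← Real.sq_sqrt ht0]
    set s := √t
    have h1 := abs_le.mp (hbd s ⟨by linarith, hle⟩)
    have h2 := abs_le.mp (hbd (-s) ⟨by linarith, by linarith⟩)
    rw [neg_sq] at h2
    simp only [eval_sub, eval_pow, eval_X, eval_C, hVeval]
    rw [abs_le]
    constructor <;> linarith [h1.1, h1.2, h2.1, h2.2]
  have hWdeg : (V - (X - C (b ^ 2)) ^ 2).natDegree ≤ n := by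
    refine (natDegree_sub_le _ _).trans (max_le hVdeg (le_trans ?_ hn))
    compute_degree
  have h := derivative_eval_zero_le_of_abs_le hWdeg (by positivity : 0 < δ ^ 2) hM hbdW
  have hd : (V - (X - C (b ^ 2)) ^ 2).derivative.eval 0 = V.derivative.eval 0 + 2 * b ^ 2 := by
    simp [derivative_pow]
  rw [hd] at h
  have : 2 * (n : ℝ) ^ 2 / δ ^ 2 * M = 2 * ((n : ℝ) ^ 2 / δ ^ 2 * M) := by ring
  linarith

/-- Iterated forward differences are bounded by the corresponding derivative. -/
lemma abs_fwdDiff_iter_le (k : ℕ) {g : ℝ → ℝ} (hg : ContDiff ℝ k g) {x h M : ℝ} (hh : 0 ≤ h)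
    (hM : ∀ y ∈ Set.Icc x (x + k * h), |iteratedDeriv k g y| ≤ M) :
    |(fwdDiff h)^[k] g x| ≤ M * h ^ k := by
  induction k generalizing g M with
  | zero => simpa using hM x (by simp)
  | succ k ih =>
    rw [Function.iterate_succ_apply, pow_succ', ← mul_assoc]
    have hgk : ContDiff ℝ k g := hg.of_le (by norm_cast; omega)
    have hgs : ContDiff ℝ k (fun y => g (y + h)) := hgk.comp (contDiff_id.add contDiff_const)
    refine ih (g := fwdDiff h g) (hgs.sub hgk) fun y hy => ?_
    have hit : iteratedDeriv k (fwdDiff h g) y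
        = iteratedDeriv k g (y + h) - iteratedDeriv k g y := by
      change iteratedDeriv k ((fun z => g (z + h)) - g) y = _
      rw [iteratedDeriv_sub hgs.contDiffAt hgk.contDiffAt, iteratedDeriv_comp_add_const]
    have hdiff : Differentiable ℝ (iteratedDeriv k g) :=
      hg.differentiable_iteratedDeriv k (by norm_cast; omega)
    have hmv := (convex_Icc y (y + h)).norm_image_sub_le_of_norm_deriv_le
      (f := iteratedDeriv k g) (C := M) (fun z _ => hdiff z) (fun z hz => ?_)
      (Set.left_mem_Icc.mpr (by linarith)) (Set.right_mem_Icc.mpr (by linarith))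
    · rw [hit]
      simpa [abs_of_nonneg hh] using hmv
    · rw [← iteratedDeriv_succ]
      refine hM z ⟨hy.1.trans hz.1, hz.2.trans ?_⟩
      push_cast
      linarith [hy.2]

lemma exists_abs_fourth_difference_le {F : ℝ → ℝ} (hF : ContDiff ℝ 4 F) :
    ∃ K, 0 ≤ K ∧ ∀ h x : ℝ, 0 < h → -1 ≤ x → x + 4 * h ≤ 1 →
      |∑ i ∈ Finset.range 5, (-1 : ℝ) ^ (4 - i) * ((4).choose i : ℝ) * F (x + (i : ℝ) * h)|
        ≤ K * h ^ 4 := by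
  obtain ⟨K, hK⟩ := isCompact_Icc.exists_bound_of_continuousOn (s := Set.Icc (-1 : ℝ) 1)
    (hF.continuous_iteratedDeriv 4 le_rfl).continuousOn
  refine ⟨K, (norm_nonneg _).trans (hK 0 (by norm_num)), fun h x hh hx hxh => ?_⟩
  have := abs_fwdDiff_iter_le 4 (g := F) hF (x := x) (h := h) (M := K) hh.le fun y hy =>
    hK y ⟨hx.trans hy.1, hy.2.trans (by push_cast; exact hxh)⟩
  rw [fwdDiff_iter_eq_sum_shift] at this
  simpa using this

/-- A smooth cutoff: `0` on `(-∞, -1/2]` and `1` on `[-1/4, ∞)`. -/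
noncomputable def cutoff (x : ℝ) : ℝ := Real.smoothTransition (4 * x + 2)

lemma contDiff_cutoff : ContDiff ℝ 5 cutoff :=
  (Real.smoothTransition.contDiff (n := 5)).comp
    ((contDiff_const.mul contDiff_id).add contDiff_const)

/-- The function `(s² - b²)₊²`, `s = x - c`, cut off to the left. -/
noncomputable def flatQuartic (c b x : ℝ) : ℝ := cutoff x * max ((x - c) ^ 2 - b ^ 2) 0 ^ 2

lemma hasDerivAt_max_zero_sq (t : ℝ) :
    HasDerivAt (fun t : ℝ => max t 0 ^ 2) (2 * max t 0) t := by
  rcases lt_trichotomy t 0 with ht | rfl | ht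
  · rw [max_eq_right ht.le, mul_zero]
    refine (hasDerivAt_const t (0 : ℝ)).congr_of_eventuallyEq ?_
    filter_upwards [Iio_mem_nhds ht] with y hy
    simp [max_eq_right (Set.mem_Iio.mp hy).le]
  · simp only [max_self, mul_zero]
    rw [hasDerivAt_iff_isLittleO_nhds_zero]
    simp only [zero_add, max_self, smul_zero, sub_zero, ne_eq, OfNat.ofNat_ne_zero,
      not_false_eq_true, zero_pow]
    refine Asymptotics.IsBigO.trans_isLittleO (g := fun h : ℝ => h ^ 2) ?_
      (Asymptotics.isLittleO_pow_id one_lt_two)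
    refine Asymptotics.IsBigO.of_bound 1 (Filter.Eventually.of_forall fun h => ?_)
    rw [one_mul, norm_pow, norm_pow]
    gcongr
    rw [Real.norm_eq_abs, Real.norm_eq_abs, abs_of_nonneg (le_max_right _ _)]
    exact max_le (le_abs_self h) (abs_nonneg h)
  · rw [max_eq_left ht.le]
    have h := (hasDerivAt_id' t).fun_pow 2
    refine HasDerivAt.congr_of_eventuallyEq (f := fun y => y ^ 2) (by simpa using h) ?_
    filter_upwards [Ioi_mem_nhds ht] with y hy
    simp [max_eq_left (Set.mem_Ioi.mp hy).le]

lemma hasDerivAt_flatQuartic (c b x : ℝ) :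
    HasDerivAt (flatQuartic c b)
      (deriv cutoff x * max ((x - c) ^ 2 - b ^ 2) 0 ^ 2
        + cutoff x * (2 * max ((x - c) ^ 2 - b ^ 2) 0 * (2 * (x - c)))) x := by
  have h1 := (contDiff_cutoff.differentiable (by norm_num) x).hasDerivAt
  have h2 : HasDerivAt (fun x : ℝ => (x - c) ^ 2 - b ^ 2) (2 * (x - c)) x := by
    simpa using (((hasDerivAt_id' x).sub_const c).fun_pow 2).sub_const (b ^ 2)
  exact h1.mul ((hasDerivAt_max_zero_sq _).comp x h2)

lemma contDiff_flatQuartic (c b : ℝ) : ContDiff ℝ 1 (flatQuartic c b) := by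
  rw [contDiff_one_iff_deriv]
  refine ⟨fun x => (hasDerivAt_flatQuartic c b x).differentiableAt, ?_⟩
  rw [funext fun x => (hasDerivAt_flatQuartic c b x).deriv]
  have h1 := contDiff_cutoff.continuous
  have h2 := contDiff_cutoff.continuous_deriv (by norm_num)
  fun_prop

/-- The derivative of `flatQuartic` is a smooth function up to `O(b³)`. -/
lemma exists_abs_deriv_flatQuartic_sub_le (c : ℝ) :
    ∃ D, 0 ≤ D ∧ ∀ b, 0 < b → b ≤ 1 → ∀ x ∈ Set.Icc (-1 : ℝ) 1,
      |deriv (flatQuartic c b) x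
        - (deriv (fun y => cutoff y * (y - c) ^ 4) x
          - 2 * b ^ 2 * deriv (fun y => cutoff y * (y - c) ^ 2) x
          + b ^ 4 * deriv cutoff x)| ≤ D * b ^ 3 := by
  obtain ⟨D, hD⟩ := isCompact_Icc.exists_bound_of_continuousOn (s := Set.Icc (-1 : ℝ) 1)
    (contDiff_cutoff.continuous_deriv (by norm_num)).continuousOn
  have hD0 : 0 ≤ D := (norm_nonneg _).trans (hD 0 (by norm_num))
  refine ⟨D + 4, by linarith, fun b hb hb1 x hx => ?_⟩
  have h1 := (contDiff_cutoff.differentiable (by norm_num) x).hasDerivAt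
  have hp (k : ℕ) : HasDerivAt (fun y : ℝ => (y - c) ^ k) (k * (x - c) ^ (k - 1)) x := by
    simpa using ((hasDerivAt_id' x).sub_const c).fun_pow k
  rw [(hasDerivAt_flatQuartic c b x).deriv, (h1.fun_mul (hp 4)).deriv, (h1.fun_mul (hp 2)).deriv]
  set s := x - c
  set u := s ^ 2 - b ^ 2 with hu
  rcases le_total 0 u with h | h
  · rw [max_eq_left h, hu]
    refine le_of_eq_of_le ?_ (by positivity : 0 ≤ (D + 4) * b ^ 3)
    rw [abs_eq_zero]
    push_cast
    ring
  · rw [max_eq_right h]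
    have hs : |s| ≤ b := abs_le_of_sq_le_sq (by linarith) hb.le
    have hub : |u| ≤ b ^ 2 := by
      rw [abs_of_nonpos h]
      nlinarith [sq_nonneg s]
    have hc : |cutoff x| ≤ 1 := by
      rw [cutoff, abs_of_nonneg (Real.smoothTransition.nonneg _)]
      exact Real.smoothTransition.le_one _
    have hd : |deriv cutoff x| ≤ D := hD x hx
    have heq : deriv cutoff x * (0 : ℝ) ^ 2 + cutoff x * (2 * 0 * (2 * s))
        - (deriv cutoff x * s ^ 4 + cutoff x * ((4 : ℕ) * s ^ (4 - 1))
          - 2 * b ^ 2 * (deriv cutoff x * s ^ 2 + cutoff x * ((2 : ℕ) * s ^ (2 - 1)))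
          + b ^ 4 * deriv cutoff x)
        = -(deriv cutoff x * u ^ 2) - cutoff x * (4 * s * u) := by
      rw [hu]
      push_cast
      ring
    rw [heq]
    have e1 : |deriv cutoff x * u ^ 2| ≤ D * b ^ 3 := by
      rw [abs_mul, abs_pow]
      calc _ ≤ D * (b ^ 2) ^ 2 := by gcongr
        _ = D * (b ^ 3 * b) := by ring
        _ ≤ D * (b ^ 3 * 1) := by gcongr
        _ = _ := by ring
    have e2 : |cutoff x * (4 * s * u)| ≤ 4 * b ^ 3 := by
      rw [abs_mul, abs_mul, abs_mul, abs_of_pos (by norm_num : (0 : ℝ) < 4)]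
      calc _ ≤ 1 * (4 * b * b ^ 2) := by gcongr
        _ = _ := by ring
    calc _ ≤ |-(deriv cutoff x * u ^ 2)| + |cutoff x * (4 * s * u)| := abs_sub _ _
      _ ≤ _ := by rw [abs_neg]; linarith

lemma exists_omegaK_deriv_flatQuartic_le (c : ℝ) :
    ∃ K, 0 ≤ K ∧ ∀ b, 0 < b → b ≤ 1 → ∀ t, 0 < t → b ^ 3 ≤ t ^ 4 →
      omegaK (iteratedDerivWithin 1 (flatQuartic c b) (Set.Icc (-1 : ℝ) 1)) 4 t (-1) 1
        ≤ K * t ^ 4 := by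
  obtain ⟨D, hD0, hD⟩ := exists_abs_deriv_flatQuartic_sub_le c
  have hsm (k : ℕ) : ContDiff ℝ 4 (deriv fun y => cutoff y * (y - c) ^ k) := by
    have : ContDiff ℝ (4 + 1) fun y => cutoff y * (y - c) ^ k :=
      ContDiff.mul (by exact_mod_cast contDiff_cutoff) ((contDiff_id.sub contDiff_const).pow k)
    exact (contDiff_succ_iff_deriv.mp this).2.2
  obtain ⟨K₀, hK₀, h₀⟩ := exists_abs_fourth_difference_le (hsm 4)
  obtain ⟨K₁, hK₁, h₁⟩ := exists_abs_fourth_difference_le (hsm 2)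
  obtain ⟨K₂, hK₂, h₂⟩ := exists_abs_fourth_difference_le (hsm 0)
  refine ⟨K₀ + 2 * K₁ + K₂ + 16 * D, by positivity, fun b hb hb1 t ht hbt => ?_⟩
  refine Real.sSup_le ?_ (by positivity)
  rintro v ⟨h, x, hh, hht, hx, hxh, rfl⟩
  push_cast at hxh
  have hmem {y : ℝ} (hy1 : -1 ≤ y) (hy2 : y ≤ 1) :
      ∃ e, |e| ≤ D * b ^ 3 ∧ iteratedDerivWithin 1 (flatQuartic c b) (Set.Icc (-1 : ℝ) 1) y
        = (deriv (fun y => cutoff y * (y - c) ^ 4) y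
          - 2 * b ^ 2 * deriv (fun y => cutoff y * (y - c) ^ 2) y
          + b ^ 4 * deriv (fun y => cutoff y * (y - c) ^ 0) y) + e := by
    refine ⟨_, hD b hb hb1 y ⟨hy1, hy2⟩, ?_⟩
    rw [iteratedDerivWithin_one, (hasDerivAt_flatQuartic c b y).differentiableAt.derivWithin
      (uniqueDiffOn_Icc (by norm_num) y ⟨hy1, hy2⟩)]
    simp only [pow_zero, mul_one]
    ring
  obtain ⟨e₀, he₀, q₀⟩ := hmem (y := x + (0 : ℕ) * h) (by push_cast; linarith) (by push_cast; linarith)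
  obtain ⟨e₁, he₁, q₁⟩ := hmem (y := x + (1 : ℕ) * h) (by push_cast; linarith) (by push_cast; linarith)
  obtain ⟨e₂, he₂, q₂⟩ := hmem (y := x + (2 : ℕ) * h) (by push_cast; linarith) (by push_cast; linarith)
  obtain ⟨e₃, he₃, q₃⟩ := hmem (y := x + (3 : ℕ) * h) (by push_cast; linarith) (by push_cast; linarith)
  obtain ⟨e₄, he₄, q₄⟩ := hmem (y := x + (4 : ℕ) * h) (by push_cast; linarith) (by push_cast; linarith)
  have g₀ := h₀ h x hh hx hxh
  have g₁ := h₁ h x hh hx hxh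
  have g₂ := h₂ h x hh hx hxh
  set S₀ := ∑ i ∈ Finset.range 5, (-1 : ℝ) ^ (4 - i) * ((4).choose i : ℝ)
    * deriv (fun y => cutoff y * (y - c) ^ 4) (x + (i : ℝ) * h) with hS₀
  set S₁ := ∑ i ∈ Finset.range 5, (-1 : ℝ) ^ (4 - i) * ((4).choose i : ℝ)
    * deriv (fun y => cutoff y * (y - c) ^ 2) (x + (i : ℝ) * h) with hS₁
  set S₂ := ∑ i ∈ Finset.range 5, (-1 : ℝ) ^ (4 - i) * ((4).choose i : ℝ)
    * deriv (fun y => cutoff y * (y - c) ^ 0) (x + (i : ℝ) * h) with hS₂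
  have hsum : ∑ i ∈ Finset.range (4 + 1), (-1 : ℝ) ^ (4 - i) * ((4).choose i : ℝ)
      * iteratedDerivWithin 1 (flatQuartic c b) (Set.Icc (-1 : ℝ) 1) (x + (i : ℝ) * h)
      = S₀ - 2 * b ^ 2 * S₁ + b ^ 4 * S₂ + (e₀ - 4 * e₁ + 6 * e₂ - 4 * e₃ + e₄) := by
    simp only [hS₀, hS₁, hS₂, Finset.sum_range_succ, Finset.sum_range_zero, q₀, q₁, q₂, q₃, q₄]
    norm_num [Nat.choose]
    ring
  rw [hsum]
  have ht4 : h ^ 4 ≤ t ^ 4 := by gcongr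
  have f₀ : |S₀| ≤ K₀ * t ^ 4 := g₀.trans (by gcongr)
  have f₁ : |2 * b ^ 2 * S₁| ≤ 2 * (K₁ * t ^ 4) := by
    rw [abs_mul, abs_of_nonneg (by positivity)]
    calc _ ≤ 2 * 1 ^ 2 * (K₁ * t ^ 4) := by gcongr; exact g₁.trans (by gcongr)
      _ = _ := by ring
  have f₂ : |b ^ 4 * S₂| ≤ K₂ * t ^ 4 := by
    rw [abs_mul, abs_of_nonneg (by positivity)]
    calc _ ≤ 1 ^ 4 * (K₂ * t ^ 4) := by gcongr; exact g₂.trans (by gcongr)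
      _ = _ := by ring
  have hDt : D * b ^ 3 ≤ D * t ^ 4 := by gcongr
  rw [abs_le] at *
  constructor <;> linarith [f₀.1, f₀.2, f₁.1, f₁.2, f₂.1, f₂.2, he₀.1, he₀.2, he₁.1, he₁.2,
    he₂.1, he₂.2, he₃.1, he₃.2, he₄.1, he₄.2]

/-- Copositive approximation with interpolatory constraints, negative result for
`f ∈ C¹` and `λ ≠ 1`: for any `A > 1`, `λ ∈ [0,1)`, `n₀ ∈ ℕ` and any positive null
sequence `(α_n)`, there are `n ≥ n₀` and `f = f_n ∈ C¹[-1,1]`, nonnegative on `[-1,1]`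
and vanishing on `[-1,-1/2]`, such that any polynomial of degree ≤ n, nonnegative on
`(λ - 1/n, λ + 1/n)`, with `P_n(λ) = f(λ)`, satisfies
`‖f - P_n‖ > A α_n n^{-2/3} ω₄(f', n⁻¹)`. -/
theorem statement10 (A : ℝ) (hA : 1 < A) (lam : ℝ) (hlam : lam ∈ Set.Ico (0 : ℝ) 1)
    (n₀ : ℕ) (hn₀ : 1 ≤ n₀) (a : ℕ → ℝ) (ha : ∀ n, 0 < a n)
    (hlim : Filter.Tendsto a Filter.atTop (nhds 0)) :
    ∃ n : ℕ, n₀ ≤ n ∧ ∃ f : ℝ → ℝ,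
      ContDiffOn ℝ 1 f (Set.Icc (-1 : ℝ) 1) ∧
      (∀ x ∈ Set.Icc (-1 : ℝ) 1, 0 ≤ f x) ∧
      (∀ x ∈ Set.Icc (-1 : ℝ) (-1/2 : ℝ), f x = 0) ∧
      ∀ P : Polynomial ℝ, P.natDegree ≤ n →
        (∀ x ∈ Set.Ioo (lam - 1 / n) (lam + 1 / n), 0 ≤ P.eval x) →
        P.eval lam = f lam →
        A * a n * (n : ℝ) ^ (-(2 : ℝ) / 3) *
            omegaK (iteratedDerivWithin 1 f (Set.Icc (-1 : ℝ) 1)) 4 ((n : ℝ)⁻¹) (-1) 1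
          < supNorm (fun x => f x - P.eval x) (-1) 1 := by
  obtain ⟨hlam0, hlam1⟩ := hlam
  obtain ⟨K, hK0, hK⟩ := exists_omegaK_deriv_flatQuartic_le lam
  obtain ⟨δ, hδ, hδ1, hδ4⟩ : ∃ δ : ℝ, 0 < δ ∧ lam + δ ≤ 1 ∧ δ ≤ 1 / 4 :=
    ⟨min (1 - lam) (1 / 4), lt_min (by linarith) (by norm_num),
      by linarith [min_le_left (1 - lam) (1 / 4)], min_le_right _ _⟩
  have hcube : Filter.Tendsto (fun m : ℕ => m ^ 3) Filter.atTop Filter.atTop :=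
    Filter.tendsto_pow_atTop (by norm_num)
  have hlimit : Filter.Tendsto (fun m : ℕ => A * K * a (m ^ 3) + ((m : ℝ)⁻¹) ^ 2)
      Filter.atTop (nhds 0) := by
    have h1 := (hlim.comp hcube).const_mul (A * K)
    have h2 := (tendsto_inv_atTop_nhds_zero_nat (𝕜 := ℝ)).pow 2
    simpa using h1.add h2
  obtain ⟨m, hmδ, hmn, hm2⟩ := ((hlimit.eventually (gt_mem_nhds (by positivity : 0 < δ ^ 2))).and
    ((hcube.eventually_ge_atTop n₀).and (Filter.eventually_ge_atTop 2))).exists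
  have hm0 : (0 : ℝ) < m := by positivity
  have hm1 : (m : ℝ)⁻¹ ≤ 1 := inv_le_one_of_one_le₀ (by exact_mod_cast (by omega : 1 ≤ m))
  set q : ℝ := (m : ℝ)⁻¹ with hq
  have hq0 : 0 < q := inv_pos.mpr hm0
  set b : ℝ := q ^ 4 with hb
  have hb0 : 0 < b := by positivity
  have hb1 : b ≤ 1 := pow_le_one₀ hq0.le hm1
  have hninv : ((m ^ 3 : ℕ) : ℝ)⁻¹ = q ^ 3 := by rw [hq, inv_pow]; push_cast; rfl
  have hnrpow : ((m ^ 3 : ℕ) : ℝ) ^ (-(2 : ℝ) / 3) = q ^ 2 := by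
    push_cast
    rw [← Real.rpow_natCast, ← Real.rpow_mul hm0.le, hq, inv_pow, ← Real.rpow_natCast,
      ← Real.rpow_neg hm0.le]
    norm_num
  refine ⟨m ^ 3, hmn, flatQuartic lam b, (contDiff_flatQuartic lam b).contDiffOn, ?_, ?_, ?_⟩
  · intro x _
    exact mul_nonneg (Real.smoothTransition.nonneg _) (sq_nonneg _)
  · rintro x ⟨_, hx⟩
    rw [flatQuartic, cutoff, Real.smoothTransition.zero_of_nonpos (by linarith), zero_mul]
  intro P hP hpos hval
  by_contra! hcon
  set E := supNorm (fun x => flatQuartic lam b x - P.eval x) (-1) 1 with hE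
  have hω := hK b hb0 hb1 (q ^ 3) (by positivity) (le_of_eq (by rw [hb]; ring))
  rw [hninv, hnrpow] at hcon
  have hEle : E ≤ A * a (m ^ 3) * q ^ 2 * (K * (q ^ 3) ^ 4) := by
    refine hcon.trans (mul_le_mul_of_nonneg_left hω ?_)
    have := ha (m ^ 3)
    positivity
  have herr (x : ℝ) (hx : x ∈ Set.Icc (-1 : ℝ) 1) : |flatQuartic lam b x - P.eval x| ≤ E := by
    refine le_csSup (IsCompact.bddAbove ?_) ⟨x, hx, rfl⟩
    refine isCompact_Icc.image_of_continuousOn (Continuous.continuousOn ?_)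
    have := (contDiff_flatQuartic lam b).continuous
    fun_prop
  have hE0 : 0 ≤ E := (abs_nonneg _).trans (herr 0 (by norm_num))
  have hP0 : P.eval lam = 0 := by
    rw [hval, flatQuartic, max_eq_right (by nlinarith [sq_nonneg b])]
    simp
  have hnpos : (0 : ℝ) < 1 / ((m ^ 3 : ℕ) : ℝ) := by
    rw [one_div, hninv]
    positivity
  have hkey := sq_le_of_abs_eval_sub_le (n := m ^ 3) (b := b) (M := E + b ^ 4)
    (hm2.trans (Nat.le_self_pow (by norm_num) m)) hP hδ hnpos (by positivity) hP0 hpos ?_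
  · have hn2 : ((m ^ 3 : ℕ) : ℝ) ^ 2 * q ^ 6 = 1 := by
      rw [hq]
      push_cast
      field_simp
    have h1 : b ^ 2 * δ ^ 2 ≤ ((m ^ 3 : ℕ) : ℝ) ^ 2 * (E + b ^ 4) := by
      rwa [div_mul_eq_mul_div, le_div_iff₀ (by positivity)] at hkey
    have h2 : E + b ^ 4 ≤ q ^ 14 * (A * K * a (m ^ 3) + q ^ 2) := by
      refine (add_le_add_left hEle _).trans (le_of_eq ?_)
      rw [hb]
      ring
    have h3 : b ^ 2 * δ ^ 2 ≤ b ^ 2 * (A * K * a (m ^ 3) + q ^ 2) := by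
      calc _ ≤ _ := h1
        _ ≤ ((m ^ 3 : ℕ) : ℝ) ^ 2 * (q ^ 14 * (A * K * a (m ^ 3) + q ^ 2)) := by gcongr
        _ = (((m ^ 3 : ℕ) : ℝ) ^ 2 * q ^ 6) * (b ^ 2 * (A * K * a (m ^ 3) + q ^ 2)) := by
          rw [hb]
          ring
        _ = _ := by rw [hn2, one_mul]
    exact absurd (le_of_mul_le_mul_left h3 (by positivity)) (not_le.mpr hmδ)
  · rintro s ⟨hs1, hs2⟩
    have h1 := herr (lam + s) ⟨by linarith, by linarith⟩
    have h2 : |flatQuartic lam b (lam + s) - (s ^ 2 - b ^ 2) ^ 2| ≤ b ^ 4 := by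
      rw [flatQuartic, cutoff, Real.smoothTransition.one_of_one_le (by linarith), one_mul,
        add_sub_cancel_left]
      rcases le_total 0 (s ^ 2 - b ^ 2) with h | h
      · rw [max_eq_left h, sub_self, abs_zero]
        positivity
      · rw [max_eq_right h, abs_le]
        constructor <;> nlinarith [sq_nonneg s, sq_nonneg b, sq_nonneg (s ^ 2 - b ^ 2)]
    rw [abs_le] at *
    constructor <;> linarith [h1.1, h1.2, h2.1, h2.2]
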